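/- arXiv:math/0701694 — 7 statements merged into one kernel-verified Lean document; each statement's English description precedes it below -/
import Mathlib

section
/- Associate to each GT tableau r the array D(r) consisting of the numbers V_{a1}(r) for 1 ≤ a ≤ ℓ and H_{ab}(r) for 1 ≤ a ≤ ℓ, 1 ≤ b ≤ ℓ+1−a. Then: (1) two GT tableaux r and s satisfy D(r) = D(s) if and only if they are equivalent; and (2) for every array of nonnegative integers (V_{a1})_{1≤a≤ℓ}, (H_{ab})_{1≤a≤ℓ, 1≤b≤ℓ+1−a} satisfying the inequalities ∑_{k=0}^{b} H_{a−k,k+1} ≤ V_{a+1,1} + ∑_{k=0}^{b} H_{a−k+1,k+1} for all 1 ≤ a ≤ ℓ and 0 ≤ b ≤ a−1 (with out-of-range H and V interpreted as 0), there exists a GT tableau r with D(r) equal to this array. Consequently D induces a bijection from the set of GT tableaux modulo equivalence onto the set of such arrays. -/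
def GTInRange (ℓ i j : ℕ) : Prop :=
  1 ≤ i ∧ i ≤ ℓ + 1 ∧ 1 ≤ j ∧ j ≤ ℓ + 2 - i

def IsGT (ℓ : ℕ) (r : ℕ → ℕ → ℕ) : Prop :=
  (∀ i j, ¬ GTInRange ℓ i j → r i j = 0) ∧
  (∀ i j, GTInRange ℓ i j → GTInRange ℓ (i + 1) j → r (i + 1) j ≤ r i j) ∧
  (∀ i j, GTInRange ℓ (i + 1) j → GTInRange ℓ i (j + 1) → r i (j + 1) ≤ r (i + 1) j)

/-- `H_{ab}(r) = r_{a+1,b} - r_{a,b+1}`. -/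
def Hgt (r : ℕ → ℕ → ℕ) (a b : ℕ) : ℤ := (r (a + 1) b : ℤ) - (r a (b + 1) : ℤ)

/-- `V_{ab}(r) = r_{ab} - r_{a+1,b}`. -/
def Vgt (r : ℕ → ℕ → ℕ) (a b : ℕ) : ℤ := (r a b : ℤ) - (r (a + 1) b : ℤ)

/-- Two GT tableaux are equivalent if `r_{ij} - s_{ij}` is independent of `(i,j)`. -/
def GTEquiv (ℓ : ℕ) (r s : ℕ → ℕ → ℕ) : Prop :=
  ∃ t : ℤ, ∀ i j, GTInRange ℓ i j → (r i j : ℤ) - (s i j : ℤ) = t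

/-- The arrays `D(r)` and `D(s)` coincide: the coordinates `V_{a1}`, `1 ≤ a ≤ ℓ`,
and `H_{ab}`, `1 ≤ a ≤ ℓ`, `1 ≤ b ≤ ℓ+1-a`, agree. -/
def SameD (ℓ : ℕ) (r s : ℕ → ℕ → ℕ) : Prop :=
  (∀ a, 1 ≤ a → a ≤ ℓ → Vgt r a 1 = Vgt s a 1) ∧
  (∀ a b, 1 ≤ a → a ≤ ℓ → 1 ≤ b → b ≤ ℓ + 1 - a → Hgt r a b = Hgt s a b)

theorem gtEquiv_of_sameD {ℓ : ℕ} {r s : ℕ → ℕ → ℕ} (h : SameD ℓ r s) : GTEquiv ℓ r s := by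
  obtain ⟨hV, hH⟩ := h
  refine ⟨(r 1 1 : ℤ) - s 1 1, fun i j hij => ?_⟩
  obtain ⟨hi, hi', hj, hj'⟩ := hij
  induction j, hj using Nat.le_induction generalizing i with
  | base =>
    induction i, hi using Nat.le_induction with
    | base => rfl
    | succ a ha ih =>
      have := hV a ha (by omega)
      have := ih (by omega) (by omega)
      simp only [Vgt] at *
      omega
  | succ b hb ih =>
    have := hH i b hi (by omega) hb (by omega)
    have := ih (i + 1) (by omega) (by omega) (by omega)
    simp only [Hgt] at *
    omega

theorem sameD_of_gtEquiv {ℓ : ℕ} {r s : ℕ → ℕ → ℕ} (h : GTEquiv ℓ r s) : SameD ℓ r s := by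
  obtain ⟨t, ht⟩ := h
  refine ⟨fun a ha ha' => ?_, fun a b ha ha' hb hb' => ?_⟩
  · have := ht a 1 ⟨by omega, by omega, by omega, by omega⟩
    have := ht (a + 1) 1 ⟨by omega, by omega, by omega, by omega⟩
    simp only [Vgt]
    omega
  · have := ht (a + 1) b ⟨by omega, by omega, by omega, by omega⟩
    have := ht a (b + 1) ⟨by omega, by omega, by omega, by omega⟩
    simp only [Hgt]
    omega

open Classical in
/-- An integer array satisfying the GT inequalities becomes a GT tableau after adding a constant. -/
theorem exists_isGT_eq_const_add {ℓ : ℕ} (z : ℕ → ℕ → ℤ)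
    (hv : ∀ i j, GTInRange ℓ i j → GTInRange ℓ (i + 1) j → z (i + 1) j ≤ z i j)
    (hh : ∀ i j, GTInRange ℓ (i + 1) j → GTInRange ℓ i (j + 1) → z i (j + 1) ≤ z (i + 1) j) :
    ∃ (r : ℕ → ℕ → ℕ) (T : ℤ), IsGT ℓ r ∧ ∀ i j, GTInRange ℓ i j → (r i j : ℤ) = T + z i j := by
  obtain ⟨T, hT⟩ : ∃ T : ℤ, ∀ i j, GTInRange ℓ i j → 0 ≤ T + z i j := by
    refine ⟨∑ p ∈ Finset.range (ℓ + 2) ×ˢ Finset.range (ℓ + 2), |z p.1 p.2|, fun i j hij => ?_⟩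
    obtain ⟨hi, hi', hj, hj'⟩ := hij
    have hmem : (i, j) ∈ Finset.range (ℓ + 2) ×ˢ Finset.range (ℓ + 2) := by
      simp only [Finset.mem_product, Finset.mem_range]
      omega
    have := Finset.single_le_sum (f := fun p : ℕ × ℕ => |z p.1 p.2|)
      (fun p _ => abs_nonneg _) hmem
    have := neg_abs_le (z i j)
    linarith
  have hr : ∀ i j, GTInRange ℓ i j →
      ((if GTInRange ℓ i j then (T + z i j).toNat else 0 : ℕ) : ℤ) = T + z i j := by
    intro i j hij
    rw [if_pos hij, Int.toNat_of_nonneg (hT i j hij)]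
  refine ⟨fun i j => if GTInRange ℓ i j then (T + z i j).toNat else 0, T,
    ⟨fun i j hij => if_neg hij, fun i j h₁ h₂ => ?_, fun i j h₁ h₂ => ?_⟩, hr⟩
  · simp only [if_pos h₁, if_pos h₂]
    exact Int.toNat_le_toNat (by linarith [hv i j h₁ h₂])
  · simp only [if_pos h₁, if_pos h₂]
    exact Int.toNat_le_toNat (by linarith [hh i j h₁ h₂])

/-- The integer array with first column differences `V`, horizontal differences `H`, and
`(ℓ + 1, 1)` entry `0`. -/
def intArray (ℓ : ℕ) (V : ℕ → ℕ) (H : ℕ → ℕ → ℕ) (i j : ℕ) : ℤ :=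
  ∑ m ∈ Finset.Ico (i + j - 1) (ℓ + 1), (V m : ℤ) -
    ∑ k ∈ Finset.range (j - 1), (H (i + j - 2 - k) (k + 1) : ℤ)

theorem intArray_sub_horizontal (ℓ : ℕ) (V : ℕ → ℕ) (H : ℕ → ℕ → ℕ) {a b : ℕ} (hb : 1 ≤ b) :
    intArray ℓ V H (a + 1) b - intArray ℓ V H a (b + 1) = H a b := by
  obtain ⟨b, rfl⟩ := Nat.exists_eq_add_of_le' hb
  have h : a + (b + 1 + 1) - 2 - b = a := by omega
  simp only [intArray, Nat.add_sub_cancel, Finset.sum_range_succ _ b, h,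
    show a + 1 + (b + 1) = a + (b + 1 + 1) by omega]
  ring

theorem intArray_sub_vertical {ℓ : ℕ} (V : ℕ → ℕ) (H : ℕ → ℕ → ℕ) {i j : ℕ}
    (hi : 1 ≤ i) (hj : 1 ≤ j) (hij : i + j ≤ ℓ + 1) :
    intArray ℓ V H i j - intArray ℓ V H (i + 1) j =
      V (i + j - 1) + ∑ k ∈ Finset.range (j - 1), (H (i + j - 2 - k + 1) (k + 1) : ℤ) -
        ∑ k ∈ Finset.range (j - 1), (H (i + j - 2 - k) (k + 1) : ℤ) := by
  have hH : ∑ k ∈ Finset.range (j - 1), (H (i + 1 + j - 2 - k) (k + 1) : ℤ) =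
      ∑ k ∈ Finset.range (j - 1), (H (i + j - 2 - k + 1) (k + 1) : ℤ) :=
    Finset.sum_congr rfl fun k hk => by
      rw [Finset.mem_range] at hk
      rw [show i + 1 + j - 2 - k = i + j - 2 - k + 1 by omega]
  rw [intArray, intArray, hH, Finset.sum_eq_sum_Ico_succ_bot (by omega),
    show i + 1 + j - 1 = i + j - 1 + 1 by omega]
  ring

/-- (1) two GT tableaux have the same array `D` iff they are
equivalent; (2) every array of nonnegative integers `(V_{a1})_{1≤a≤ℓ}`,
`(H_{ab})_{1≤a≤ℓ, 1≤b≤ℓ+1-a}` satisfying the inequalities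
`∑_{k=0}^{b} H_{a-k,k+1} ≤ V_{a+1,1} + ∑_{k=0}^{b} H_{a-k+1,k+1}`
(`1 ≤ a ≤ ℓ`, `0 ≤ b ≤ a-1`, out-of-range terms interpreted as `0`) arises
as `D(r)` for some GT tableau `r`. -/
theorem stmt_3 (ℓ : ℕ) (hℓ : 1 ≤ ℓ) :
    (∀ r s : ℕ → ℕ → ℕ, IsGT ℓ r → IsGT ℓ s → (SameD ℓ r s ↔ GTEquiv ℓ r s)) ∧
    (∀ (V' : ℕ → ℕ) (H' : ℕ → ℕ → ℕ),
      (∀ a b : ℕ, 1 ≤ a → a ≤ ℓ → b ≤ a - 1 →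
        (∑ k ∈ Finset.range (b + 1),
            (if 1 ≤ a - k ∧ a - k ≤ ℓ ∧ 1 ≤ k + 1 ∧ k + 1 ≤ ℓ + 1 - (a - k)
              then (H' (a - k) (k + 1) : ℤ) else 0)) ≤
          (if 1 ≤ a + 1 ∧ a + 1 ≤ ℓ then (V' (a + 1) : ℤ) else 0) +
          ∑ k ∈ Finset.range (b + 1),
            (if 1 ≤ a - k + 1 ∧ a - k + 1 ≤ ℓ ∧ 1 ≤ k + 1 ∧ k + 1 ≤ ℓ + 1 - (a - k + 1)
              then (H' (a - k + 1) (k + 1) : ℤ) else 0)) →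
      ∃ r : ℕ → ℕ → ℕ, IsGT ℓ r ∧
        (∀ a, 1 ≤ a → a ≤ ℓ → Vgt r a 1 = (V' a : ℤ)) ∧
        (∀ a b, 1 ≤ a → a ≤ ℓ → 1 ≤ b → b ≤ ℓ + 1 - a → Hgt r a b = (H' a b : ℤ))) := by
  refine ⟨fun r s _ _ => ⟨gtEquiv_of_sameD, sameD_of_gtEquiv⟩, fun V' H' hineq => ?_⟩
  have hv : ∀ i j, GTInRange ℓ i j → GTInRange ℓ (i + 1) j →
      intArray ℓ V' H' (i + 1) j ≤ intArray ℓ V' H' i j := by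
    rintro i j ⟨hi, -, hj, -⟩ ⟨-, hi', -, hj'⟩
    have h := intArray_sub_vertical (ℓ := ℓ) V' H' hi hj (by omega)
    obtain rfl | hj₂ : j = 1 ∨ 2 ≤ j := by omega
    · simp only [Nat.add_sub_cancel, Nat.sub_self, Finset.range_zero, Finset.sum_empty] at h
      linarith [Int.natCast_nonneg (V' i)]
    · have key := hineq (i + j - 2) (j - 2) (by omega) (by omega) (by omega)
      rw [show j - 2 + 1 = j - 1 by omega, show i + j - 2 + 1 = i + j - 1 by omega,
        if_pos (by omega),
        Finset.sum_congr rfl fun k hk => if_pos (by rw [Finset.mem_range] at hk; omega),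
        Finset.sum_congr rfl fun k hk => if_pos (by rw [Finset.mem_range] at hk; omega)] at key
      linarith
  have hh : ∀ i j, GTInRange ℓ (i + 1) j → GTInRange ℓ i (j + 1) →
      intArray ℓ V' H' i (j + 1) ≤ intArray ℓ V' H' (i + 1) j := by
    rintro i j ⟨-, -, hj, -⟩ -
    have h := intArray_sub_horizontal ℓ V' H' (a := i) hj
    linarith [Int.natCast_nonneg (H' i j)]
  obtain ⟨r, T, hGT, hr⟩ := exists_isGT_eq_const_add _ hv hh
  refine ⟨r, hGT, fun a ha ha' => ?_, fun a b ha ha' hb hb' => ?_⟩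
  · have h := intArray_sub_vertical (ℓ := ℓ) V' H' ha le_rfl (by omega)
    simp only [Nat.add_sub_cancel, Nat.sub_self, Finset.range_zero, Finset.sum_empty] at h
    rw [Vgt, hr a 1 ⟨by omega, by omega, by omega, by omega⟩,
      hr (a + 1) 1 ⟨by omega, by omega, by omega, by omega⟩]
    linarith
  · have h := intArray_sub_horizontal ℓ V' H' (a := a) hb
    rw [Hgt, hr (a + 1) b ⟨by omega, by omega, by omega, by omega⟩,
      hr a (b + 1) ⟨by omega, by omega, by omega, by omega⟩]
    linarith
end

section
/- Let 0 < q < 1. There exist constants c₂ > c₁ > 0, depending only on q and ℓ, such that for every GT tableau r, every a with 1 ≤ a ≤ ℓ, and all indices j, k with 1 ≤ j ≤ ℓ+2−a, 1 ≤ k ≤ ℓ+1−a for which adding 1 to r_{aj} and to r_{a+1,k} again yields a GT interlacing pattern (rows a−1, a, a+1 still interlace), the quantity X = q^{−r_{aj}+r_{a+1,k}−k+j} · ∏_{1≤i≤ℓ+2−a, i≠j} ([r_{a,i}−r_{a+1,k}−i+k]_q / [r_{a,i}−r_{a,j}−i+j]_q) · ∏_{1≤i≤ℓ+1−a, i≠k}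 ([r_{a+1,i}−r_{a,j}−i+j−1]_q / [r_{a+1,i}−r_{a+1,k}−i+k−1]_q) satisfies c₁ · q^{2A} ≤ |X| ≤ c₂ · q^{2A}, where A = ∑_{min(j,k) ≤ b < max(j,k)} H_{ab}(r) + 2 · ∑_{k < b < j} V_{ab}(r) (an empty sum being zero). -/
/-- The `q`-number `[n]_q = (qⁿ - q⁻ⁿ)/(q - q⁻¹)`. -/
noncomputable def qnum (q : ℝ) (n : ℤ) : ℝ := (q ^ n - q ^ (-n)) / (q - q⁻¹)

/-- The array obtained from `r` by adding `1` to the entries `r_{a,j}` and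
`r_{a+1,k}`. -/
def bump2 (r : ℕ → ℕ → ℕ) (a j k : ℕ) : ℕ → ℕ → ℕ :=
  fun i' j' => if (i' = a ∧ j' = j) ∨ (i' = a + 1 ∧ j' = k) then r i' j' + 1 else r i' j'

/-- The quantity `X` of STATEMENT 4 (the square of a CG coefficient factor). -/
noncomputable def Xfac (ℓ : ℕ) (q : ℝ) (r : ℕ → ℕ → ℕ) (a j k : ℕ) : ℝ :=
  q ^ (-(r a j : ℤ) + (r (a + 1) k : ℤ) - (k : ℤ) + (j : ℤ)) *
    (∏ i ∈ (Finset.Icc 1 (ℓ + 2 - a)).erase j,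
      qnum q ((r a i : ℤ) - (r (a + 1) k : ℤ) - (i : ℤ) + (k : ℤ)) /
        qnum q ((r a i : ℤ) - (r a j : ℤ) - (i : ℤ) + (j : ℤ))) *
    (∏ i ∈ (Finset.Icc 1 (ℓ + 1 - a)).erase k,
      qnum q ((r (a + 1) i : ℤ) - (r a j : ℤ) - (i : ℤ) + (j : ℤ) - 1) /
        qnum q ((r (a + 1) i : ℤ) - (r (a + 1) k : ℤ) - (i : ℤ) + (k : ℤ) - 1))

/-- `A = ∑_{min(j,k) ≤ b < max(j,k)} H_{ab}(r) + 2 ∑_{k < b < j} V_{ab}(r)`. -/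
def Aexp (r : ℕ → ℕ → ℕ) (a j k : ℕ) : ℤ :=
  (∑ b ∈ Finset.Ico (min j k) (max j k), Hgt r a b) +
    2 * ∑ b ∈ Finset.Ioo k j, Vgt r a b

open Finset

/-- `|x|` agrees with `q ^ e` up to a factor in `[exp (-K), exp K]`, on a logarithmic scale. -/
def LogNear (q K x : ℝ) (e : ℤ) : Prop :=
  x ≠ 0 ∧ |Real.log |x| - e * Real.log q| ≤ K

namespace LogNear

variable {q K L x y : ℝ} {e f : ℤ}

lemma mul (hx : LogNear q K x e) (hy : LogNear q L y f) :
    LogNear q (K + L) (x * y) (e + f) := by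
  refine ⟨mul_ne_zero hx.1 hy.1, ?_⟩
  rw [abs_mul, Real.log_mul (abs_ne_zero.2 hx.1) (abs_ne_zero.2 hy.1)]
  push_cast
  have h₁ := abs_le.1 hx.2
  have h₂ := abs_le.1 hy.2
  rw [abs_le]
  constructor <;> linarith [h₁.1, h₁.2, h₂.1, h₂.2]

lemma div (hx : LogNear q K x e) (hy : LogNear q L y f) :
    LogNear q (K + L) (x / y) (e - f) := by
  refine ⟨div_ne_zero hx.1 hy.1, ?_⟩
  rw [abs_div, Real.log_div (abs_ne_zero.2 hx.1) (abs_ne_zero.2 hy.1)]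
  push_cast
  have h₁ := abs_le.1 hx.2
  have h₂ := abs_le.1 hy.2
  rw [abs_le]
  constructor <;> linarith [h₁.1, h₁.2, h₂.1, h₂.2]

lemma mono (hx : LogNear q K x e) (h : K ≤ L) : LogNear q L x e :=
  ⟨hx.1, hx.2.trans h⟩

lemma prod {ι : Type*} {s : Finset ι} {g : ι → ℝ} {e : ι → ℤ}
    (h : ∀ i ∈ s, LogNear q K (g i) (e i)) :
    LogNear q (s.card * K) (∏ i ∈ s, g i) (∑ i ∈ s, e i) := by
  classical
  induction s using Finset.induction_on with
  | empty => simp [LogNear]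
  | insert a s ha ih =>
    rw [prod_insert ha, sum_insert ha, card_insert_of_notMem ha]
    have := (h a (mem_insert_self a s)).mul (ih fun i hi => h i (mem_insert_of_mem hi))
    refine this.mono (le_of_eq ?_)
    push_cast
    ring

lemma zpow_mul_exp_le (hq : 0 < q) (hx : LogNear q K x e) :
    Real.exp (-K) * q ^ e ≤ |x| ∧ |x| ≤ Real.exp K * q ^ e := by
  have h := abs_le.1 hx.2
  have he : q ^ e = Real.exp (e * Real.log q) := by
    rw [← Real.log_zpow, Real.exp_log (zpow_pos hq e)]
  have hx' : |x| = Real.exp (Real.log |x|) := (Real.exp_log (abs_pos.2 hx.1)).symm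
  rw [he, ← Real.exp_add, ← Real.exp_add, hx', Real.exp_le_exp, Real.exp_le_exp]
  constructor <;> linarith [h.1, h.2]

end LogNear

lemma logNear_zpow {q S : ℝ} (hq0 : 0 < q) {m u : ℤ} (h : |((m - u : ℤ) : ℝ)| ≤ S) :
    LogNear q (S * |Real.log q|) (q ^ m) u := by
  refine ⟨(zpow_pos hq0 m).ne', ?_⟩
  rw [abs_of_pos (zpow_pos hq0 m), Real.log_zpow, ← sub_mul, abs_mul, ← Int.cast_sub]
  exact mul_le_mul_of_nonneg_right h (abs_nonneg _)

lemma abs_qnum_abs (q : ℝ) (m : ℤ) : |(qnum q (|m|))| = |qnum q m| := by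
  rcases abs_choice m with h | h <;> rw [h]
  rw [← abs_neg]
  congr 1
  simp only [qnum, neg_neg]
  ring

/-- The logarithmic error in `|[m]_q| ≈ q ^ (-|m|)`. -/
noncomputable def qnumErr (q : ℝ) : ℝ := |Real.log (1 - q ^ 2)| + |Real.log (q⁻¹ - q)|

lemma abs_qnum_of_pos {q : ℝ} (hq0 : 0 < q) (hq1 : q < 1) {m : ℤ} (hm : 0 < m) :
    |qnum q m| = q ^ (-m) * (1 - q ^ (2 * m)) / (q⁻¹ - q) ∧ q ^ (2 * m) ≤ q ^ 2 := by
  have hinv : 1 < q⁻¹ := (one_lt_inv₀ hq0).2 hq1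
  have hle : q ^ (2 * m) ≤ q ^ 2 := by
    rw [← zpow_natCast q 2]
    exact zpow_le_zpow_right_of_le_one₀ hq0 hq1.le (by push_cast; omega)
  refine ⟨?_, hle⟩
  have h2 : q ^ 2 < 1 := by nlinarith
  have heq : qnum q m = q ^ (-m) * (1 - q ^ (2 * m)) / (q⁻¹ - q) := by
    have : q ^ (-m) * q ^ (2 * m) = q ^ m := by
      rw [← zpow_add₀ hq0.ne']
      congr 1
      ring
    rw [mul_sub, this, mul_one, qnum, ← neg_sub (q ^ (-m)), ← neg_sub q⁻¹, neg_div_neg_eq]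
  rw [heq]
  apply abs_of_nonneg
  have := zpow_pos hq0 (-m)
  apply div_nonneg (mul_nonneg this.le _) <;> linarith

lemma logNear_qnum {q : ℝ} (hq0 : 0 < q) (hq1 : q < 1) {m : ℤ} (hm : m ≠ 0) :
    LogNear q (qnumErr q) (qnum q m) (-|m|) := by
  obtain ⟨h, hle⟩ := abs_qnum_of_pos hq0 hq1 (abs_pos.2 hm)
  rw [abs_qnum_abs] at h
  have hinv : 1 < q⁻¹ := (one_lt_inv₀ hq0).2 hq1
  have h2 : q ^ 2 < 1 := by nlinarith
  have hz := zpow_pos hq0 (-|m|)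
  have hz2 := zpow_pos hq0 (2 * |m|)
  have hd : 0 < 1 - q ^ (2 * |m|) := by linarith
  have hc : 0 < q⁻¹ - q := by linarith
  refine ⟨abs_pos.1 (h ▸ by positivity), ?_⟩
  rw [h, Real.log_div (by positivity) hc.ne', Real.log_mul hz.ne' hd.ne', Real.log_zpow]
  have l1 : Real.log (1 - q ^ 2) ≤ Real.log (1 - q ^ (2 * |m|)) :=
    Real.log_le_log (by linarith) (by linarith)
  have l2 : Real.log (1 - q ^ (2 * |m|)) ≤ 0 := Real.log_nonpos hd.le (by linarith)
  have l3 := neg_abs_le (Real.log (1 - q ^ 2))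
  have l4 := neg_abs_le (Real.log (q⁻¹ - q))
  have l5 := le_abs_self (Real.log (q⁻¹ - q))
  have l6 := abs_nonneg (Real.log (1 - q ^ 2))
  rw [qnumErr, abs_le]
  constructor <;> linarith

lemma logNear_qnum_shift {q S : ℝ} (hq0 : 0 < q) (hq1 : q < 1) {m u : ℤ} (hm : m ≠ 0)
    (h : |((m - u : ℤ) : ℝ)| ≤ S) :
    LogNear q (qnumErr q + S * |Real.log q|) (qnum q m) (-|u|) := by
  obtain ⟨h0, h1⟩ := logNear_qnum hq0 hq1 hm
  refine ⟨h0, ?_⟩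
  have h2 : |((-|m| - -|u| : ℤ) : ℝ)| ≤ S := by
    refine le_trans ?_ h
    have := abs_abs_sub_abs_le m u
    have h3 : |(-|m| - -|u|)| ≤ |m - u| := by
      rwa [neg_sub_neg, abs_sub_comm]
    exact_mod_cast h3
  calc _ = |(Real.log |qnum q m| - ((-|m| : ℤ) : ℝ) * Real.log q) +
        ((-|m| - -|u| : ℤ) : ℝ) * Real.log q| := by push_cast; congr 1; ring
    _ ≤ _ := (abs_add_le _ _).trans (add_le_add h1 (by
        rw [abs_mul]; exact mul_le_mul_of_nonneg_right h2 (abs_nonneg _)))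

/-- `x` (of length `n + 1`) and `y` (of length `n`) interlace: `x₁ ≥ y₁ ≥ x₂ ≥ ⋯ ≥ yₙ ≥ xₙ₊₁`. -/
def Interlaces (n : ℕ) (x y : ℕ → ℤ) : Prop :=
  ∀ i, 1 ≤ i → i ≤ n → y i ≤ x i ∧ x (i + 1) ≤ y i

namespace Interlaces

variable {n : ℕ} {x y : ℕ → ℤ}

lemma top_le_top (h : Interlaces n x y) {i j : ℕ} (hi : 1 ≤ i) (hij : i ≤ j) (hj : j ≤ n + 1) :
    x j ≤ x i := by
  induction j, hij using Nat.le_induction with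
  | base => rfl
  | succ j hij ih =>
    have := h j (by omega) (by omega)
    linarith [ih (by omega), this.1, this.2]

lemma bot_le_top (h : Interlaces n x y) {i j : ℕ} (hi : 1 ≤ i) (hij : i ≤ j) (hj : j ≤ n) :
    y j ≤ x i :=
  (h j (by omega) hj).1.trans (h.top_le_top hi hij (by omega))

lemma top_le_bot (h : Interlaces n x y) {i j : ℕ} (hi : 1 ≤ i) (hij : i < j) (hj : j ≤ n + 1) :
    x j ≤ y i :=
  (h.top_le_top (by omega) hij hj).trans (h i hi (by omega)).2

lemma bot_le_bot (h : Interlaces n x y) {i j : ℕ} (hi : 1 ≤ i) (hij : i ≤ j) (hj : j ≤ n) :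
    y j ≤ y i := by
  rcases hij.eq_or_lt with rfl | hij
  · rfl
  · exact (h j (by omega) hj).1.trans (h.top_le_bot hi hij (by omega))

end Interlaces

lemma sum_abs_sub_eq {n m : ℕ} {x y : ℕ → ℤ} {t : ℤ} (hm : 1 ≤ m) (hmn : m ≤ n + 1)
    (hlow : ∀ i, 1 ≤ i → i < m → t ≤ x i ∧ t ≤ y i)
    (hhigh : ∀ i, m ≤ i → i ≤ n → x i ≤ t ∧ y i ≤ t) (hlast : x (n + 1) ≤ t) :
    ∑ i ∈ Icc 1 (n + 1), |x i - t| - ∑ i ∈ Icc 1 n, |y i - t| =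
      2 * ∑ i ∈ Ico 1 m, (x i - y i) - ∑ i ∈ Ico 1 (n + 1), (x i - y i) + t - x (n + 1) := by
  have hsplit := sum_Ico_consecutive (fun i => x i - y i) hm hmn
  have hsplit' := sum_Ico_consecutive (fun i => |x i - t| - |y i - t|) hm hmn
  have h1 : ∑ i ∈ Ico 1 m, (|x i - t| - |y i - t|) = ∑ i ∈ Ico 1 m, (x i - y i) := by
    refine sum_congr rfl fun i hi => ?_
    rw [mem_Ico] at hi
    have := hlow i hi.1 hi.2
    rw [abs_of_nonneg (by linarith [this.1]), abs_of_nonneg (by linarith [this.2])]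
    ring
  have h2 : ∑ i ∈ Ico m (n + 1), (|x i - t| - |y i - t|) = -∑ i ∈ Ico m (n + 1), (x i - y i) := by
    rw [← sum_neg_distrib]
    refine sum_congr rfl fun i hi => ?_
    rw [mem_Ico] at hi
    have := hhigh i hi.1 (by omega)
    rw [abs_of_nonpos (by linarith [this.1]), abs_of_nonpos (by linarith [this.2])]
    ring
  have h3 : ∑ i ∈ Icc 1 (n + 1), |x i - t| = ∑ i ∈ Icc 1 n, |x i - t| + |x (n + 1) - t| :=
    sum_Icc_succ_top (by omega) _
  have h4 : Icc 1 n = Ico 1 (n + 1) := by ext; simp [Nat.succ_le_iff]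
  rw [abs_of_nonpos (by linarith)] at h3
  rw [h3, h4]
  rw [h1, h2, sum_sub_distrib (s := Ico 1 (n + 1))] at hsplit'
  linarith

lemma sum_diag_gaps_of_le {x y : ℕ → ℤ} {j k : ℕ} (hjk : j ≤ k) :
    ∑ b ∈ Ico j k, (y b - x (b + 1)) = x j - y k - ∑ i ∈ Ico j (k + 1), (x i - y i) := by
  induction k, hjk using Nat.le_induction with
  | base => simp
  | succ k hjk ih =>
    rw [sum_Ico_succ_top hjk, ih, sum_Ico_succ_top (b := k + 1) (by omega)]
    ring

lemma sum_diag_gaps_of_lt {x y : ℕ → ℤ} {j k : ℕ} (hkj : k + 1 ≤ j) :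
    ∑ b ∈ Ico k j, (y b - x (b + 1)) = y k - x j - ∑ i ∈ Ico (k + 1) j, (x i - y i) := by
  induction j, hkj using Nat.le_induction with
  | base => simp
  | succ j hjk ih =>
    rw [sum_Ico_succ_top (by omega), ih, sum_Ico_succ_top hjk]
    ring

lemma two_mul_Aexp {r : ℕ → ℕ → ℕ} {a j k n : ℕ}
    (h : Interlaces n (fun i => r a i) (fun i => r (a + 1) i))
    (hj : 1 ≤ j) (hjn : j ≤ n + 1) (hk : 1 ≤ k) (hkn : k ≤ n) :
    2 * Aexp r a j k = (-(r a j : ℤ) + r (a + 1) k) +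
      ∑ i ∈ (Icc 1 (n + 1)).erase j,
        (-|(r a i : ℤ) - r (a + 1) k| - -|(r a i : ℤ) - r a j|) +
      ∑ i ∈ (Icc 1 n).erase k,
        (-|(r (a + 1) i : ℤ) - r a j| - -|(r (a + 1) i : ℤ) - r (a + 1) k|) := by
  set x : ℕ → ℤ := fun i => r a i with hx
  set y : ℕ → ℤ := fun i => r (a + 1) i with hy
  change _ = (-x j + y k) + ∑ i ∈ (Icc 1 (n + 1)).erase j, (-|x i - y k| - -|x i - x j|) +
    ∑ i ∈ (Icc 1 n).erase k, (-|y i - x j| - -|y i - y k|)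
  have hFx := sum_abs_sub_eq (n := n) (m := j) (x := x) (y := y) (t := x j) hj hjn
    (fun i hi hij => ⟨h.top_le_top hi hij.le hjn, h.top_le_bot hi hij hjn⟩)
    (fun i hji hi => ⟨h.top_le_top hj hji (by omega), h.bot_le_top hj hji hi⟩)
    (h.top_le_top hj hjn le_rfl)
  have hFy := sum_abs_sub_eq (n := n) (m := k + 1) (x := x) (y := y) (t := y k)
    (by omega) (by omega)
    (fun i hi hik => ⟨h.bot_le_top hi (by omega) hkn, h.bot_le_bot hi (by omega) hkn⟩)
    (fun i hki hi => ⟨h.top_le_bot hk hki (by omega), h.bot_le_bot hk (by omega) hi⟩)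
    (h.top_le_bot hk (by omega) le_rfl)
  rw [sum_erase_eq_sub (by simp; omega), sum_erase_eq_sub (by simp; omega)]
  simp only [sum_sub_distrib, sum_neg_distrib, sub_self, abs_zero, neg_zero] at hFx hFy ⊢
  have hA : Aexp r a j k = |x j - y k| + ∑ i ∈ Ico 1 j, (x i - y i) -
      ∑ i ∈ Ico 1 (k + 1), (x i - y i) := by
    have hA' : Aexp r a j k = (∑ b ∈ Ico (min j k) (max j k), (y b - x (b + 1))) +
      2 * ∑ b ∈ Ioo k j, (x b - y b) := rfl
    rw [hA']
    rcases le_or_gt j k with hjk | hkj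
    · rw [min_eq_left hjk, max_eq_right hjk, sum_diag_gaps_of_le hjk, Ioo_eq_empty (by omega),
        abs_of_nonneg (sub_nonneg.2 (h.bot_le_top hj hjk hkn))]
      have := sum_Ico_consecutive (fun i => x i - y i) hj (show j ≤ k + 1 by omega)
      simp only [sum_empty]
      linarith
    · have hI : Ioo k j = Ico (k + 1) j := by ext; simp
      rw [min_eq_right hkj.le, max_eq_left hkj.le, sum_diag_gaps_of_lt hkj, hI,
        abs_of_nonpos (sub_nonpos.2 (h.top_le_bot hk hkj hjn))]
      have := sum_Ico_consecutive (fun i => x i - y i) (show 1 ≤ k + 1 by omega)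
        (show k + 1 ≤ j from hkj)
      linarith
  simp only [sum_sub_distrib] at hA
  rw [hA, abs_sub_comm (y k) (x j)]
  linarith

lemma IsGT.interlaces {ℓ : ℕ} {r : ℕ → ℕ → ℕ} (h : IsGT ℓ r) {a : ℕ} (ha : 1 ≤ a) (haℓ : a ≤ ℓ) :
    Interlaces (ℓ + 1 - a) (fun i => r a i) (fun i => r (a + 1) i) := by
  intro i hi hin
  have h1 := h.2.1 a i (by unfold GTInRange; omega) (by unfold GTInRange; omega)
  have h2 := h.2.2 a i (by unfold GTInRange; omega) (by unfold GTInRange; omega)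
  exact ⟨Int.ofNat_le.2 h1, Int.ofNat_le.2 h2⟩

lemma bump2_args_ne_zero {r : ℕ → ℕ → ℕ} {a j k n : ℕ}
    (h : Interlaces n (fun i => r a i) (fun i => r (a + 1) i))
    (hb : Interlaces n (fun i => bump2 r a j k a i) (fun i => bump2 r a j k (a + 1) i))
    (hj : 1 ≤ j) (hjn : j ≤ n + 1) (hk : 1 ≤ k) (hkn : k ≤ n) :
    (∀ i, 1 ≤ i → i ≤ n + 1 → i ≠ j → (r a i : ℤ) - r (a + 1) k - i + k ≠ 0) ∧
    (∀ i, 1 ≤ i → i ≤ n + 1 → i ≠ j → (r a i : ℤ) - r a j - i + j ≠ 0) ∧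
    (∀ i, 1 ≤ i → i ≤ n → i ≠ k → (r (a + 1) i : ℤ) - r a j - i + j - 1 ≠ 0) ∧
    (∀ i, 1 ≤ i → i ≤ n → i ≠ k → (r (a + 1) i : ℤ) - r (a + 1) k - i + k - 1 ≠ 0) := by
  have hbx : ∀ i, bump2 r a j k a i = if i = j then r a i + 1 else r a i := by
    intro i
    simp [bump2]
  have hby : ∀ i, bump2 r a j k (a + 1) i = if i = k then r (a + 1) i + 1 else r (a + 1) i := by
    intro i
    simp [bump2]
  simp only [hbx, hby] at hb
  refine ⟨fun i hi hin hij => ?_, fun i hi hin hij => ?_, fun i hi hin hik => ?_,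
    fun i hi hin hik => ?_⟩
  · rcases lt_trichotomy i k with hik | rfl | hki
    · have := h.bot_le_top hi hik.le hkn
      omega
    · have := hb.bot_le_top hi le_rfl hkn
      rw [if_pos rfl, if_neg hij] at this
      omega
    · have := h.top_le_bot hk hki hin
      omega
  · rcases lt_or_gt_of_ne hij with hij | hji
    · have := h.top_le_top hi hij.le hjn
      omega
    · have := h.top_le_top hj hji.le hin
      omega
  · rcases lt_or_ge i j with hij | hji
    · have := hb.top_le_bot hi hij hjn
      rw [if_pos rfl, if_neg hik] at this
      omega
    · have := h.bot_le_top hj hji hin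
      omega
  · rcases lt_or_gt_of_ne hik with hik' | hki
    · have := hb.bot_le_bot hi hik'.le hkn
      rw [if_pos rfl, if_neg hik] at this
      omega
    · have := h.bot_le_bot hk hki.le hin
      omega

/-- there are constants `0 < c₁ < c₂` depending only on `q` and
`ℓ` such that `c₁ q^{2A} ≤ |X| ≤ c₂ q^{2A}` for every GT tableau `r`, every
`1 ≤ a ≤ ℓ` and all admissible indices `j, k`. -/
theorem stmt_4 (ℓ : ℕ) (hℓ : 1 ≤ ℓ) (q : ℝ) (hq0 : 0 < q) (hq1 : q < 1) :
    ∃ c₁ c₂ : ℝ, 0 < c₁ ∧ c₁ < c₂ ∧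
      ∀ (r : ℕ → ℕ → ℕ) (a j k : ℕ), IsGT ℓ r →
        1 ≤ a → a ≤ ℓ → 1 ≤ j → j ≤ ℓ + 2 - a → 1 ≤ k → k ≤ ℓ + 1 - a →
        IsGT ℓ (bump2 r a j k) →
        c₁ * q ^ (2 * Aexp r a j k) ≤ |Xfac ℓ q r a j k| ∧
          |Xfac ℓ q r a j k| ≤ c₂ * q ^ (2 * Aexp r a j k) := by
  set S : ℝ := ℓ + 2 with hS
  have hS0 : 0 ≤ S := by positivity
  set K₁ : ℝ := qnumErr q + S * |Real.log q| with hK₁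
  have hK₁0 : 0 ≤ K₁ := by unfold K₁ qnumErr; positivity
  set K : ℝ := S * |Real.log q| + S * (K₁ + K₁) + S * (K₁ + K₁) with hK
  have hK0 : 0 ≤ K := by positivity
  refine ⟨Real.exp (-(K + 1)), Real.exp (K + 1), Real.exp_pos _, Real.exp_lt_exp.2 (by linarith), ?_⟩
  intro r a j k hr ha haℓ hj hjn hk hkn hb
  have h := hr.interlaces ha haℓ
  have hb' := hb.interlaces ha haℓ
  have hn : ℓ + 2 - a = (ℓ + 1 - a) + 1 := by omega
  have hnℓ : ℓ + 1 - a ≤ ℓ := by omega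
  rw [hn] at hjn
  rw [two_mul_Aexp h hj hjn hk hkn]
  refine LogNear.zpow_mul_exp_le hq0 (LogNear.mono (K := K) ?_ (by linarith))
  unfold Xfac
  rw [hn]
  clear_value S
  generalize ℓ + 1 - a = n at *
  have hshift : ∀ {z : ℤ}, |z| ≤ ℓ + 2 → |(z : ℝ)| ≤ S := by
    intro z hz
    rw [hS]
    exact_mod_cast hz
  have hq : ∀ {m u : ℤ}, m ≠ 0 → |m - u| ≤ ℓ + 2 → LogNear q K₁ (qnum q m) (-|u|) :=
    fun hm hmu => logNear_qnum_shift hq0 hq1 hm (hshift hmu)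
  have hcard : ∀ {s : Finset ℕ}, s.card ≤ ℓ + 1 → (s.card : ℝ) * (K₁ + K₁) ≤ S * (K₁ + K₁) := by
    intro s hs
    have : (s.card : ℝ) ≤ ℓ + 1 := by exact_mod_cast hs
    exact mul_le_mul_of_nonneg_right (by linarith) (by linarith)
  obtain ⟨hne₁, hne₂, hne₃, hne₄⟩ := bump2_args_ne_zero h hb' hj hjn hk hkn
  refine LogNear.mul (LogNear.mul ?_ ?_) ?_
  · refine logNear_zpow hq0 (hshift ?_)
    rw [abs_le]
    constructor <;> omega
  · refine (LogNear.prod fun i hi => ?_).mono (hcard ?_)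
    · rw [mem_erase, mem_Icc] at hi
      obtain ⟨hij, hi1, hin⟩ := hi
      exact (hq (hne₁ i hi1 hin hij) (abs_le.2 ⟨by omega, by omega⟩)).div
        (hq (hne₂ i hi1 hin hij) (abs_le.2 ⟨by omega, by omega⟩))
    · exact (card_erase_le).trans (by simp; omega)
  · refine (LogNear.prod fun i hi => ?_).mono (hcard ?_)
    · rw [mem_erase, mem_Icc] at hi
      obtain ⟨hik, hi1, hin⟩ := hi
      exact (hq (hne₃ i hi1 hin hik) (abs_le.2 ⟨by omega, by omega⟩)).div
        (hq (hne₄ i hi1 hin hik) (abs_le.2 ⟨by omega, by omega⟩))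
    · exact (card_erase_le).trans (by simp; omega)
end

section
/- Let 0 < q < 1. There exist constants c₂ > c₁ > 0, depending only on q and ℓ, such that for every GT tableau r, every a with 1 ≤ a ≤ ℓ, and every index j with 1 ≤ j ≤ ℓ+2−a for which adding 1 to r_{aj} again yields a GT interlacing pattern, the quantity Y = q^{(1−j+∑_{i=1}^{ℓ+1−a} r_{a+1,i} − ∑_{1≤i≤ℓ+2−a, i≠j} r_{a,i})} · (∏_{i=1}^{ℓ+1−a} [r_{a+1,i}−r_{aj}−i+j−1]_q) / (∏_{1≤i≤ℓ+2−a, i≠j} [r_{a,i}−r_{aj}−i+j]_q) satisfies c₁ · q^{2B} ≤ |Y| ≤ c₂ · q^{2B}, where B = ∑_{j ≤ b < ℓ+2−a} H_{ab}(r) (an empty sum being zero). -/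
/-- The array obtained from `r` by adding `1` to the entry `r_{a,j}`. -/
def bump1 (r : ℕ → ℕ → ℕ) (a j : ℕ) : ℕ → ℕ → ℕ :=
  fun i' j' => if i' = a ∧ j' = j then r i' j' + 1 else r i' j'

/-- The quantity `Y` of STATEMENT 5 (the square of a CG coefficient factor). -/
noncomputable def Yfac (ℓ : ℕ) (q : ℝ) (r : ℕ → ℕ → ℕ) (a j : ℕ) : ℝ :=
  q ^ ((1 : ℤ) - (j : ℤ) + (∑ i ∈ Finset.Icc 1 (ℓ + 1 - a), (r (a + 1) i : ℤ)) -
        ∑ i ∈ (Finset.Icc 1 (ℓ + 2 - a)).erase j, (r a i : ℤ)) *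
    (∏ i ∈ Finset.Icc 1 (ℓ + 1 - a),
      qnum q ((r (a + 1) i : ℤ) - (r a j : ℤ) - (i : ℤ) + (j : ℤ) - 1)) /
    (∏ i ∈ (Finset.Icc 1 (ℓ + 2 - a)).erase j,
      qnum q ((r a i : ℤ) - (r a j : ℤ) - (i : ℤ) + (j : ℤ)))

/-- `B = ∑_{j ≤ b < ℓ+2-a} H_{ab}(r)`. -/
def Bexp (ℓ : ℕ) (r : ℕ → ℕ → ℕ) (a j : ℕ) : ℤ :=
  ∑ b ∈ Finset.Ico j (ℓ + 2 - a), Hgt r a b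

lemma qnum_neg (q : ℝ) (n : ℤ) : qnum q (-n) = -qnum q n := by
  unfold qnum
  rw [neg_neg, ← neg_div, neg_sub]

lemma qnum_eq {q : ℝ} (hq0 : 0 < q) (hq1 : q < 1) (n : ℤ) :
    qnum q n = q ^ (1 - n) * (1 - q ^ (2 * n)) / (1 - q ^ 2) := by
  have h1 : q - q⁻¹ ≠ 0 := (sub_neg.2 (hq1.trans ((one_lt_inv₀ hq0).2 hq1))).ne
  have h2 : 1 - q ^ 2 ≠ 0 := by nlinarith
  have h3 : q ^ n ≠ 0 := zpow_ne_zero _ hq0.ne'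
  unfold qnum
  rw [div_eq_div_iff h1 h2, mul_comm 2 n, zpow_mul, zpow_sub₀ hq0.ne', zpow_neg]
  norm_cast
  field_simp
  ring

lemma le_abs_qnum {q : ℝ} (hq0 : 0 < q) (hq1 : q < 1) {n : ℤ} (hn : 0 < n) :
    q ^ (1 - n) ≤ |qnum q n| ∧ |qnum q n| ≤ q ^ (1 - n) / (1 - q ^ 2) := by
  have h2 : 0 < 1 - q ^ 2 := by nlinarith
  have hpos : 0 < q ^ (2 * n) := zpow_pos hq0 _
  have hle : q ^ (2 * n) ≤ q ^ 2 := by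
    exact_mod_cast zpow_le_zpow_right_of_le_one₀ hq0 hq1.le (by omega : (2 : ℤ) ≤ 2 * n)
  have hE : 0 < q ^ (1 - n) := zpow_pos hq0 _
  rw [qnum_eq hq0 hq1, abs_of_nonneg (by
    have : 0 ≤ 1 - q ^ (2 * n) := by linarith
    positivity)]
  constructor
  · rw [le_div_iff₀ h2]
    gcongr
  · gcongr
    exact mul_le_of_le_one_right hE.le (by linarith)

/-- Comparison of a quotient of `q`-numbers at positive integers with a power of `q`. -/
lemma abs_zpow_mul_qnum_div_of_pos {q : ℝ} (hq0 : 0 < q) (hq1 : q < 1) {n m : ℤ} (hn : 0 < n)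
    (hm : 0 < m) (e : ℤ) :
    (1 - q ^ 2) * q ^ (e - n + m) ≤ |q ^ e * qnum q n / qnum q m| ∧
      |q ^ e * qnum q n / qnum q m| ≤ (1 - q ^ 2)⁻¹ * q ^ (e - n + m) := by
  have h2 : 0 < 1 - q ^ 2 := by nlinarith
  obtain ⟨hn1, hn2⟩ := le_abs_qnum hq0 hq1 hn
  obtain ⟨hm1, hm2⟩ := le_abs_qnum hq0 hq1 hm
  have hE : 0 < q ^ e := zpow_pos hq0 _
  have hpm : 0 < q ^ (1 - m) := zpow_pos hq0 _
  have hpn : 0 < q ^ (1 - n) := zpow_pos hq0 _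
  have hm0 : 0 < |qnum q m| := hpm.trans_le hm1
  have key : q ^ (e - n + m) * q ^ (1 - m) = q ^ e * q ^ (1 - n) := by
    rw [← zpow_add₀ hq0.ne', ← zpow_add₀ hq0.ne']
    congr 1
    ring
  have hX : 0 < q ^ (e - n + m) := zpow_pos hq0 _
  rw [abs_div, abs_mul, abs_of_pos hE]
  constructor
  · rw [le_div_iff₀ hm0]
    calc (1 - q ^ 2) * q ^ (e - n + m) * |qnum q m|
        ≤ (1 - q ^ 2) * q ^ (e - n + m) * (q ^ (1 - m) / (1 - q ^ 2)) := by gcongr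
      _ = q ^ e * q ^ (1 - n) := by rw [← key]; field_simp
      _ ≤ _ := by gcongr
  · rw [div_le_iff₀ hm0]
    calc q ^ e * |qnum q n| ≤ q ^ e * (q ^ (1 - n) / (1 - q ^ 2)) := by gcongr
      _ = (1 - q ^ 2)⁻¹ * q ^ (e - n + m) * q ^ (1 - m) := by
        rw [mul_assoc _ _ (q ^ (1 - m)), key]; field_simp
      _ ≤ _ := by gcongr

lemma abs_zpow_mul_qnum_div_of_neg {q : ℝ} (hq0 : 0 < q) (hq1 : q < 1) {n m : ℤ} (hn : n < 0)
    (hm : m < 0) (e : ℤ) :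
    (1 - q ^ 2) * q ^ (e + n - m) ≤ |q ^ e * qnum q n / qnum q m| ∧
      |q ^ e * qnum q n / qnum q m| ≤ (1 - q ^ 2)⁻¹ * q ^ (e + n - m) := by
  have h := abs_zpow_mul_qnum_div_of_pos hq0 hq1 (neg_pos.2 hn) (neg_pos.2 hm) e
  rwa [qnum_neg, qnum_neg, mul_neg, neg_div_neg_eq, sub_neg_eq_add, ← sub_eq_add_neg] at h

/-- Enumerate `{1, …, N + 1} \ {j}` increasingly by `{1, …, N}`. -/
@[to_additive]
lemma prod_Icc_erase {M : Type*} [CommMonoid M] (N j : ℕ) (hj : 1 ≤ j) (hjN : j ≤ N + 1)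
    (f : ℕ → M) :
    ∏ i ∈ (Finset.Icc 1 (N + 1)).erase j, f i =
      ∏ i ∈ Finset.Icc 1 N, f (if i < j then i else i + 1) := by
  symm
  refine Finset.prod_nbij' (fun i => if i < j then i else i + 1)
    (fun i => if i < j then i else i - 1) ?_ ?_ ?_ ?_ (fun _ _ => rfl)
  all_goals
    intro i hi
    simp only [Finset.mem_erase, Finset.mem_Icc] at hi ⊢
    grind

lemma sum_Icc_ite_lt (N j : ℕ) (hj : 1 ≤ j) (hjN : j ≤ N + 1) :
    ∑ i ∈ Finset.Icc 1 N, (if i < j then (-1 : ℤ) else 0) = 1 - j := by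
  rw [← Finset.sum_filter, show (Finset.Icc 1 N).filter (· < j) = Finset.Ico 1 j by
    ext i; simp only [Finset.mem_filter, Finset.mem_Icc, Finset.mem_Ico]; omega]
  simp [Nat.cast_sub hj]

lemma Bexp_eq_sum (ℓ : ℕ) (r : ℕ → ℕ → ℕ) (a j : ℕ) (ha : a ≤ ℓ) (hj : 1 ≤ j) :
    Bexp ℓ r a j = ∑ i ∈ Finset.Icc 1 (ℓ + 1 - a), if i < j then 0 else Hgt r a i := by
  simp_rw [Bexp, ← not_le, ite_not]
  rw [← Finset.sum_filter]
  congr 1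
  ext i
  simp only [Finset.mem_filter, Finset.mem_Icc, Finset.mem_Ico]
  omega

lemma zpow_sum {ι : Type*} {q : ℝ} (hq : q ≠ 0) (s : Finset ι) (f : ι → ℤ) :
    q ^ (∑ i ∈ s, f i) = ∏ i ∈ s, q ^ f i := by
  classical
  induction s using Finset.induction_on with
  | empty => simp
  | insert i s hi ih => rw [Finset.sum_insert hi, Finset.prod_insert hi, zpow_add₀ hq, ih]

lemma Yfac_eq_prod {ℓ : ℕ} {q : ℝ} (hq0 : 0 < q) (r : ℕ → ℕ → ℕ) {a j : ℕ} (ha : a ≤ ℓ)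
    (hj : 1 ≤ j) (hjl : j ≤ ℓ + 2 - a) :
    Yfac ℓ q r a j = ∏ i ∈ Finset.Icc 1 (ℓ + 1 - a),
      (q ^ ((if i < j then (-1 : ℤ) else 0) + r (a + 1) i - r a (if i < j then i else i + 1)) *
        qnum q ((r (a + 1) i : ℤ) - r a j - i + j - 1) /
        qnum q ((r a (if i < j then i else i + 1) : ℤ) - r a j -
          (if i < j then i else i + 1 : ℕ) + j)) := by
  have hN : ℓ + 2 - a = (ℓ + 1 - a) + 1 := by omega
  rw [hN] at hjl
  rw [Finset.prod_div_distrib, Finset.prod_mul_distrib, ← zpow_sum hq0.ne',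
    Finset.sum_sub_distrib, Finset.sum_add_distrib, sum_Icc_ite_lt _ _ hj hjl, Yfac, hN,
    prod_Icc_erase _ _ hj hjl, sum_Icc_erase _ _ hj hjl]

lemma IsGT.row_antitone {ℓ : ℕ} {r : ℕ → ℕ → ℕ} (hr : IsGT ℓ r) {a : ℕ} (ha1 : 1 ≤ a)
    (ha : a ≤ ℓ) {i k : ℕ} (hi : 1 ≤ i) (hik : i ≤ k) (hk : k ≤ ℓ + 2 - a) :
    r a k ≤ r a i := by
  induction k, hik using Nat.le_induction with
  | base => exact le_rfl
  | succ k hik ih =>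
    have h1 := hr.2.1 a k (by unfold GTInRange; omega) (by unfold GTInRange; omega)
    have h2 := hr.2.2 a k (by unfold GTInRange; omega) (by unfold GTInRange; omega)
    exact h2.trans (h1.trans (ih (by omega)))

/-- there are constants `0 < c₁ < c₂` depending only on `q` and
`ℓ` such that `c₁ q^{2B} ≤ |Y| ≤ c₂ q^{2B}` for every GT tableau `r`, every
`1 ≤ a ≤ ℓ` and every admissible index `j`. -/
theorem stmt_5 (ℓ : ℕ) (hℓ : 1 ≤ ℓ) (q : ℝ) (hq0 : 0 < q) (hq1 : q < 1) :
    ∃ c₁ c₂ : ℝ, 0 < c₁ ∧ c₁ < c₂ ∧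
      ∀ (r : ℕ → ℕ → ℕ) (a j : ℕ), IsGT ℓ r →
        1 ≤ a → a ≤ ℓ → 1 ≤ j → j ≤ ℓ + 2 - a →
        IsGT ℓ (bump1 r a j) →
        c₁ * q ^ (2 * Bexp ℓ r a j) ≤ |Yfac ℓ q r a j| ∧
          |Yfac ℓ q r a j| ≤ c₂ * q ^ (2 * Bexp ℓ r a j) := by
  have hc0 : 0 < 1 - q ^ 2 := by nlinarith
  have hc1 : 1 - q ^ 2 < 1 := by nlinarith
  have hc2 : 1 < (1 - q ^ 2)⁻¹ := (one_lt_inv₀ hc0).2 hc1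
  refine ⟨(1 - q ^ 2) ^ ℓ, (1 - q ^ 2)⁻¹ ^ ℓ, by positivity,
    (pow_lt_one₀ hc0.le hc1 (by omega)).trans (one_lt_pow₀ hc2 (by omega)), ?_⟩
  intro r a j hr ha1 ha hj hjl hb
  have hX : 0 < q ^ (2 * Bexp ℓ r a j) := zpow_pos hq0 _
  have hB : q ^ (2 * Bexp ℓ r a j) = ∏ i ∈ Finset.Icc 1 (ℓ + 1 - a),
      q ^ (2 * if i < j then 0 else Hgt r a i) := by
    rw [Bexp_eq_sum ℓ r a j ha hj, Finset.mul_sum, zpow_sum hq0.ne']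
  have hbump : ∀ i, 1 ≤ i → i < j → r a j + 1 ≤ r (a + 1) i := by
    intro i hi hij
    have h := hb.row_antitone ha1 ha (Nat.succ_pos i) hij hjl
    have h' := hb.2.2 a i (by unfold GTInRange; omega) (by unfold GTInRange; omega)
    simpa [bump1] using h.trans h'
  have hfactor : ∀ i ∈ Finset.Icc 1 (ℓ + 1 - a),
      (1 - q ^ 2) * q ^ (2 * if i < j then 0 else Hgt r a i) ≤
        |q ^ ((if i < j then (-1 : ℤ) else 0) + r (a + 1) i -
            r a (if i < j then i else i + 1)) *
          qnum q ((r (a + 1) i : ℤ) - r a j - i + j - 1) /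
          qnum q ((r a (if i < j then i else i + 1) : ℤ) - r a j -
            (if i < j then i else i + 1 : ℕ) + j)| ∧
        |q ^ ((if i < j then (-1 : ℤ) else 0) + r (a + 1) i -
            r a (if i < j then i else i + 1)) *
          qnum q ((r (a + 1) i : ℤ) - r a j - i + j - 1) /
          qnum q ((r a (if i < j then i else i + 1) : ℤ) - r a j -
            (if i < j then i else i + 1 : ℕ) + j)| ≤
        (1 - q ^ 2)⁻¹ * q ^ (2 * if i < j then 0 else Hgt r a i) := by
    intro i hi
    rw [Finset.mem_Icc] at hi
    split_ifs with hij
    · have h1 := hbump i hi.1 hij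
      have h2 := hr.row_antitone ha1 ha hi.1 hij.le hjl
      have := abs_zpow_mul_qnum_div_of_pos hq0 hq1
        (n := (r (a + 1) i : ℤ) - r a j - i + j - 1) (m := (r a i : ℤ) - r a j - i + j)
        (by omega) (by omega) (-1 + r (a + 1) i - r a i)
      convert this using 4 <;> ring
    · have h1 := hr.row_antitone ha1 ha hj (not_lt.1 hij) (by omega)
      have h2 := hr.row_antitone ha1 ha hj (by omega : j ≤ i + 1) (by omega)
      have h3 := hr.2.1 a i (by unfold GTInRange; omega) (by unfold GTInRange; omega)
      have := abs_zpow_mul_qnum_div_of_neg hq0 hq1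
        (n := (r (a + 1) i : ℤ) - r a j - i + j - 1)
        (m := (r a (i + 1) : ℤ) - r a j - (i + 1 : ℕ) + j)
        (by omega) (by omega) (0 + r (a + 1) i - r a (i + 1))
      convert this using 4 <;> unfold Hgt <;> push_cast <;> ring
  rw [Yfac_eq_prod hq0 r ha hj hjl, Finset.abs_prod]
  constructor
  · calc (1 - q ^ 2) ^ ℓ * q ^ (2 * Bexp ℓ r a j)
        ≤ (1 - q ^ 2) ^ (ℓ + 1 - a) * q ^ (2 * Bexp ℓ r a j) :=
          mul_le_mul_of_nonneg_right
            (pow_le_pow_of_le_one hc0.le hc1.le (by omega)) hX.le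
      _ = ∏ i ∈ Finset.Icc 1 (ℓ + 1 - a),
          ((1 - q ^ 2) * q ^ (2 * if i < j then 0 else Hgt r a i)) := by
        rw [hB, Finset.prod_mul_distrib, Finset.prod_const, Nat.card_Icc, Nat.add_sub_cancel]
      _ ≤ _ := Finset.prod_le_prod (fun i _ => mul_nonneg hc0.le (zpow_pos hq0 _).le)
          fun i hi => (hfactor i hi).1
  · calc _ ≤ ∏ i ∈ Finset.Icc 1 (ℓ + 1 - a),
          ((1 - q ^ 2)⁻¹ * q ^ (2 * if i < j then 0 else Hgt r a i)) :=
        Finset.prod_le_prod (fun i _ => abs_nonneg _) fun i hi => (hfactor i hi).2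
      _ = (1 - q ^ 2)⁻¹ ^ (ℓ + 1 - a) * q ^ (2 * Bexp ℓ r a j) := by
        rw [hB, Finset.prod_mul_distrib, Finset.prod_const, Nat.card_Icc, Nat.add_sub_cancel]
      _ ≤ _ := mul_le_mul_of_nonneg_right
            (pow_le_pow_right₀ hc2.le (by omega)) hX.le
end

section
/- Let λ = (λ₁ ≥ λ₂ ≥ … ≥ λ_{ℓ+1} ≥ 0) be a vector of nonnegative integers. The minimum of ψ(r) over all GT tableaux r with top row λ (i.e. r_{1j} = λ_j for 1 ≤ j ≤ ℓ+1) equals −(ℓ/2)·∑_{j=1}^{ℓ+1} λ_j + ∑_{k=2}^{ℓ+1} (k−1)·λ_k, and it is attained at the GT tableau given by r_{ij} = λ_{i+j−1}. -/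
/-- `ψ(r) = -(ℓ/2) ∑_{j=1}^{ℓ+1} r_{1j} + ∑_{i=2}^{ℓ+1} ∑_{j=1}^{ℓ+2-i} r_{ij}`. -/
noncomputable def psiGT (ℓ : ℕ) (r : ℕ → ℕ → ℕ) : ℝ :=
  -(ℓ : ℝ) / 2 * (∑ j ∈ Finset.Icc 1 (ℓ + 1), (r 1 j : ℝ)) +
    ∑ i ∈ Finset.Icc 2 (ℓ + 1), ∑ j ∈ Finset.Icc 1 (ℓ + 2 - i), (r i j : ℝ)

/-- `ψ_min(λ) = -(ℓ/2) ∑_{j=1}^{ℓ+1} λ_j + ∑_{k=2}^{ℓ+1} (k-1) λ_k`. -/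
noncomputable def psiMin (ℓ : ℕ) (lam : ℕ → ℕ) : ℝ :=
  -(ℓ : ℝ) / 2 * (∑ j ∈ Finset.Icc 1 (ℓ + 1), (lam j : ℝ)) +
    ∑ k ∈ Finset.Icc 2 (ℓ + 1), ((k : ℝ) - 1) * (lam k : ℝ)

/-- The GT tableau with top row `λ` given by `r_{ij} = λ_{i+j-1}`. -/
def minTab (ℓ : ℕ) (lam : ℕ → ℕ) : ℕ → ℕ → ℕ :=
  fun i j => if 1 ≤ i ∧ i ≤ ℓ + 1 ∧ 1 ≤ j ∧ j ≤ ℓ + 2 - i then lam (i + j - 1) else 0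

/-- Summing `f` along the rows `i ≥ 2` of the triangle, each `f k` is counted once for every
row `2 ≤ i ≤ k`. -/
theorem sum_triangle_eq (ℓ : ℕ) (f : ℕ → ℝ) :
    ∑ i ∈ Finset.Icc 2 (ℓ + 1), ∑ j ∈ Finset.Icc 1 (ℓ + 2 - i), f (i + j - 1) =
      ∑ k ∈ Finset.Icc 2 (ℓ + 1), ((k : ℝ) - 1) * f k := by
  have hrow : ∀ i ∈ Finset.Icc 2 (ℓ + 1), ∑ j ∈ Finset.Icc 1 (ℓ + 2 - i), f (i + j - 1) =
      ∑ k ∈ Finset.Icc i (ℓ + 1), f k := by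
    intro i hi
    rw [Finset.mem_Icc] at hi
    refine Finset.sum_nbij' (fun j => i + j - 1) (fun k => k + 1 - i) ?_ ?_ ?_ ?_
      (fun _ _ => rfl) <;>
      simp only [Finset.mem_Icc] <;> omega
  rw [Finset.sum_congr rfl hrow, Finset.sum_comm' (t' := Finset.Icc 2 (ℓ + 1))
    (s' := fun k => Finset.Icc 2 k) (by simp only [Finset.mem_Icc]; omega)]
  refine Finset.sum_congr rfl fun k hk => ?_
  rw [Finset.mem_Icc] at hk
  rw [Finset.sum_const, Nat.card_Icc, nsmul_eq_mul, show k + 1 - 2 = k - 1 by omega,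
    Nat.cast_sub (by omega), Nat.cast_one]

theorem minTab_of_inRange {ℓ i j : ℕ} (lam : ℕ → ℕ) (h : GTInRange ℓ i j) :
    minTab ℓ lam i j = lam (i + j - 1) :=
  if_pos h

theorem isGT_minTab (ℓ : ℕ) (lam : ℕ → ℕ)
    (hmono : ∀ j, 1 ≤ j → j ≤ ℓ → lam (j + 1) ≤ lam j) : IsGT ℓ (minTab ℓ lam) := by
  refine ⟨fun i j h => if_neg h, fun i j h h' => ?_, fun i j h h' => ?_⟩ <;>
    rw [minTab_of_inRange lam h, minTab_of_inRange lam h'] <;> unfold GTInRange at h h'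
  · have := hmono (i + j - 1) (by omega) (by omega)
    rwa [show i + j - 1 + 1 = i + 1 + j - 1 by omega] at this
  · rw [show i + (j + 1) - 1 = i + 1 + j - 1 by omega]

/-- Entries of a GT tableau are bounded below by the top-row entry on the same antidiagonal. -/
theorem IsGT.topRow_le {ℓ : ℕ} {r : ℕ → ℕ → ℕ} (hr : IsGT ℓ r) {i j : ℕ}
    (h : GTInRange ℓ i j) : r 1 (i + j - 1) ≤ r i j := by
  obtain ⟨hi, -⟩ := id h
  induction i, hi using Nat.le_induction generalizing j with
  | base => simp
  | succ i hi ih =>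
    have h' : GTInRange ℓ i (j + 1) := by unfold GTInRange at *; omega
    have := ih h'
    rw [show i + (j + 1) - 1 = i + 1 + j - 1 by omega] at this
    exact this.trans (hr.2.2 i j h h')

/-- for a Young tableau `λ₁ ≥ λ₂ ≥ … ≥ λ_{ℓ+1} ≥ 0`, the minimum
of `ψ(r)` over all GT tableaux `r` with top row `λ` equals
`-(ℓ/2) ∑_{j=1}^{ℓ+1} λ_j + ∑_{k=2}^{ℓ+1} (k-1) λ_k`, attained at the tableau
`r_{ij} = λ_{i+j-1}`. -/
theorem stmt_7 (ℓ : ℕ) (hℓ : 1 ≤ ℓ) (lam : ℕ → ℕ)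
    (hmono : ∀ j, 1 ≤ j → j ≤ ℓ → lam (j + 1) ≤ lam j) :
    IsGT ℓ (minTab ℓ lam) ∧
    (∀ j, 1 ≤ j → j ≤ ℓ + 1 → minTab ℓ lam 1 j = lam j) ∧
    psiGT ℓ (minTab ℓ lam) = psiMin ℓ lam ∧
    (∀ r : ℕ → ℕ → ℕ, IsGT ℓ r → (∀ j, 1 ≤ j → j ≤ ℓ + 1 → r 1 j = lam j) →
      psiMin ℓ lam ≤ psiGT ℓ r) := by
  refine ⟨isGT_minTab ℓ lam hmono, fun j h1 h2 => ?_, ?_, fun r hr htop => ?_⟩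
  · rw [minTab_of_inRange lam (by unfold GTInRange; omega), Nat.add_sub_cancel_left]
  · unfold psiGT psiMin
    rw [← sum_triangle_eq ℓ fun k => (lam k : ℝ)]
    congr 1
    · congr 1
      refine Finset.sum_congr rfl fun j hj => ?_
      rw [Finset.mem_Icc] at hj
      rw [minTab_of_inRange lam (by unfold GTInRange; omega), Nat.add_sub_cancel_left]
    · refine Finset.sum_congr rfl fun i hi => Finset.sum_congr rfl fun j hj => ?_
      rw [Finset.mem_Icc] at hi hj
      rw [minTab_of_inRange lam (by unfold GTInRange; omega)]
  · unfold psiGT psiMin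
    rw [← sum_triangle_eq ℓ fun k => (lam k : ℝ)]
    refine add_le_add (le_of_eq ?_) ?_
    · congr 1
      refine Finset.sum_congr rfl fun j hj => ?_
      rw [Finset.mem_Icc] at hj
      rw [htop j hj.1 hj.2]
    · refine Finset.sum_le_sum fun i hi => Finset.sum_le_sum fun j hj => ?_
      rw [Finset.mem_Icc] at hi hj
      rw [← htop (i + j - 1) (by omega) (by omega)]
      exact_mod_cast hr.topRow_le (by unfold GTInRange; omega)
end

section
/- Let 0 < q < 1. There exist constants K₂ > K₁ > 0, depending only on q and ℓ, such that for every GT tableau r and every move M admissible for r, the quantity κ(r, M(r)) = (d_λ / d_μ)^{1/2} · q^{ψ(r) − ψ(M(r))} satisfies K₁ < κ(r, M(r)) < K₂, where λ is the top row of r and μ is the top row of M(r). -/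
/-- The set of GT tableaux with top row `λ`. -/
def GTwith (ℓ : ℕ) (lam : ℕ → ℕ) : Set (ℕ → ℕ → ℕ) :=
  {r | IsGT ℓ r ∧ ∀ j, 1 ≤ j → j ≤ ℓ + 1 → r 1 j = lam j}

/-- `d_λ = ∑_{r : top row λ} q^{2ψ(r)}` (a finite sum of positive terms). -/
noncomputable def dLam (ℓ : ℕ) (q : ℝ) (lam : ℕ → ℕ) : ℝ :=
  ∑ᶠ r ∈ GTwith ℓ lam, q ^ (2 * psiGT ℓ r)

/-- The array `M(r)` obtained from `r` by adding `1` to the entry `r_{a, m_a}`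
for each `1 ≤ a ≤ i`. -/
def moveGT (r : ℕ → ℕ → ℕ) (i : ℕ) (M : ℕ → ℕ) : ℕ → ℕ → ℕ :=
  fun a b => if 1 ≤ a ∧ a ≤ i ∧ b = M a then r a b + 1 else r a b

/-- `κ(r, s) = (d_λ/d_μ)^{1/2} q^{ψ(r) - ψ(s)}`, where `λ`, `μ` are the top
rows of `r` and `s`. -/
noncomputable def kappaGT (ℓ : ℕ) (q : ℝ) (r s : ℕ → ℕ → ℕ) : ℝ :=
  Real.sqrt (dLam ℓ q (r 1) / dLam ℓ q (s 1)) * q ^ (psiGT ℓ r - psiGT ℓ s)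

theorem IsGT.row_succ_le {ℓ : ℕ} {r : ℕ → ℕ → ℕ} (hr : IsGT ℓ r) {i j : ℕ}
    (h : GTInRange ℓ (i + 1) j) (hi : 1 ≤ i) : r (i + 1) j ≤ r i j :=
  hr.2.1 i j (by unfold GTInRange at *; omega) h

theorem IsGT.succ_col_le {ℓ : ℕ} {r : ℕ → ℕ → ℕ} (hr : IsGT ℓ r) {i j : ℕ}
    (h : GTInRange ℓ (i + 1) j) (hi : 1 ≤ i) : r i (j + 1) ≤ r (i + 1) j :=
  hr.2.2 i j h (by unfold GTInRange at *; omega)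

theorem IsGT.top_row_antitone {ℓ : ℕ} {r : ℕ → ℕ → ℕ} (hr : IsGT ℓ r) {j : ℕ}
    (h1 : 1 ≤ j) (h2 : j + 1 ≤ ℓ + 1) : r 1 (j + 1) ≤ r 1 j := by
  have h : GTInRange ℓ (1 + 1) j := by unfold GTInRange; omega
  exact (hr.succ_col_le h le_rfl).trans (hr.row_succ_le h le_rfl)

theorem IsGT.top_le {ℓ : ℕ} {r : ℕ → ℕ → ℕ} (hr : IsGT ℓ r) {i : ℕ} (hi : 1 ≤ i) :
    ∀ {j : ℕ}, GTInRange ℓ i j → r 1 (i + j - 1) ≤ r i j := by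
  induction i, hi using Nat.le_induction with
  | base => intro j _; rw [Nat.add_sub_cancel_left]
  | succ i hi ih =>
    intro j h
    have h' := ih (j := j + 1) (by unfold GTInRange at *; omega)
    rw [show i + 1 + j - 1 = i + (j + 1) - 1 by omega]
    exact h'.trans (hr.succ_col_le h hi)

theorem IsGT.le_top {ℓ : ℕ} {r : ℕ → ℕ → ℕ} (hr : IsGT ℓ r) {i : ℕ} (hi : 1 ≤ i) :
    ∀ {j : ℕ}, GTInRange ℓ i j → r i j ≤ r 1 j := by
  induction i, hi using Nat.le_induction with
  | base => intro j _; exact le_rfl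
  | succ i hi ih =>
    intro j h
    exact (hr.row_succ_le h hi).trans (ih (by unfold GTInRange at *; omega))

theorem IsGT.top_row_le_first {ℓ : ℕ} {r : ℕ → ℕ → ℕ} (hr : IsGT ℓ r) {j : ℕ} (hj : 1 ≤ j) :
    j ≤ ℓ + 1 → r 1 j ≤ r 1 1 := by
  induction j, hj using Nat.le_induction with
  | base => intro _; exact le_rfl
  | succ j hj ih =>
    intro h
    exact (hr.top_row_antitone hj h).trans (ih (by omega))

open Classical in
/-- The entrywise smallest GT tableau with top row `lam`. -/
noncomputable def minGT (ℓ : ℕ) (lam : ℕ → ℕ) : ℕ → ℕ → ℕ :=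
  fun i j => if GTInRange ℓ i j then lam (i + j - 1) else 0

theorem minGT_mem {ℓ : ℕ} {lam : ℕ → ℕ}
    (hlam : ∀ j, 1 ≤ j → j + 1 ≤ ℓ + 1 → lam (j + 1) ≤ lam j) :
    minGT ℓ lam ∈ GTwith ℓ lam := by
  refine ⟨⟨fun i j h => if_neg h, fun i j h h' => ?_, fun i j h h' => ?_⟩, fun j h1 h2 => ?_⟩
  · rw [minGT, if_pos h', minGT, if_pos h, show i + 1 + j - 1 = i + j - 1 + 1 by have := h.1; omega]
    unfold GTInRange at *
    exact hlam _ (by omega) (by omega)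
  · rw [minGT, if_pos h', minGT, if_pos h, show i + 1 + j - 1 = i + (j + 1) - 1 by omega]
  · rw [minGT, if_pos (by unfold GTInRange; omega), Nat.add_sub_cancel_left]

/-- The positions below the top row of a GT tableau. -/
def lowerIndices (ℓ : ℕ) : Finset (Σ _ : ℕ, ℕ) :=
  (Finset.Icc 2 (ℓ + 1)).sigma fun i => Finset.Icc 1 (ℓ + 2 - i)

theorem mem_lowerIndices {ℓ : ℕ} {a : Σ _ : ℕ, ℕ} :
    a ∈ lowerIndices ℓ ↔ 2 ≤ a.1 ∧ GTInRange ℓ a.1 a.2 := by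
  simp only [lowerIndices, Finset.mem_sigma, Finset.mem_Icc, GTInRange]
  omega

theorem psiGT_eq_sum_lowerIndices (ℓ : ℕ) (r : ℕ → ℕ → ℕ) :
    psiGT ℓ r = -(ℓ : ℝ) / 2 * (∑ j ∈ Finset.Icc 1 (ℓ + 1), (r 1 j : ℝ)) +
      ∑ a : lowerIndices ℓ, (r a.1.1 a.1.2 : ℝ) := by
  rw [psiGT, Finset.sum_coe_sort (lowerIndices ℓ) fun a => (r a.1 a.2 : ℝ), lowerIndices,
    Finset.sum_sigma]

/-- The excess of the lower entries of `r` over those of the smallest tableau with top row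
`lam`. -/
def excess (ℓ : ℕ) (lam : ℕ → ℕ) (r : ℕ → ℕ → ℕ) : lowerIndices ℓ → ℕ :=
  fun a => r a.1.1 a.1.2 - lam (a.1.1 + a.1.2 - 1)

theorem lam_add_excess {ℓ : ℕ} {lam : ℕ → ℕ} {r : ℕ → ℕ → ℕ} (hr : r ∈ GTwith ℓ lam)
    (a : lowerIndices ℓ) :
    r a.1.1 a.1.2 = lam (a.1.1 + a.1.2 - 1) + excess ℓ lam r a := by
  obtain ⟨h2, ha⟩ := mem_lowerIndices.1 a.2
  have h := hr.1.top_le (by omega) ha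
  rw [hr.2 _ (by unfold GTInRange at ha; omega) (by unfold GTInRange at ha; omega)] at h
  unfold excess
  omega

theorem excess_injOn (ℓ : ℕ) (lam : ℕ → ℕ) : Set.InjOn (excess ℓ lam) (GTwith ℓ lam) := by
  intro r hr s hs h
  funext i j
  by_cases hij : GTInRange ℓ i j
  · by_cases hi : i = 1
    · subst hi
      have h1 : 1 ≤ j := hij.2.2.1
      have h2 : j ≤ ℓ + 1 := by unfold GTInRange at hij; omega
      rw [hr.2 j h1 h2, hs.2 j h1 h2]
    · have ha : (⟨i, j⟩ : Σ _ : ℕ, ℕ) ∈ lowerIndices ℓ :=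
        mem_lowerIndices.2 ⟨by have := hij.1; dsimp only; omega, hij⟩
      have e1 := lam_add_excess hr ⟨_, ha⟩
      have e2 := lam_add_excess hs ⟨_, ha⟩
      rw [h, ← e2] at e1
      exact e1
  · rw [hr.1.1 i j hij, hs.1.1 i j hij]

theorem excess_mapsTo (ℓ : ℕ) (lam : ℕ → ℕ) :
    Set.MapsTo (excess ℓ lam) (GTwith ℓ lam)
      (Fintype.piFinset fun _ : lowerIndices ℓ => Finset.range (lam 1 + 1)) := by
  intro r hr
  rw [Finset.mem_coe, Fintype.mem_piFinset]
  intro a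
  obtain ⟨h2, ha⟩ := mem_lowerIndices.1 a.2
  have h := hr.1.le_top (by omega) ha
  have h' := hr.1.top_row_le_first ha.2.2.1 (by unfold GTInRange at ha; omega)
  rw [hr.2 1 le_rfl (by omega)] at h'
  rw [Finset.mem_range, excess]
  omega

theorem finite_GTwith (ℓ : ℕ) (lam : ℕ → ℕ) : (GTwith ℓ lam).Finite :=
  Set.Finite.of_injOn (excess_mapsTo ℓ lam) (excess_injOn ℓ lam) (Finset.finite_toSet _)

theorem psiGT_eq_min_add_excess {ℓ : ℕ} {lam : ℕ → ℕ} {r : ℕ → ℕ → ℕ}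
    (hr : r ∈ GTwith ℓ lam) :
    psiGT ℓ r = psiGT ℓ (minGT ℓ lam) + ((∑ a, excess ℓ lam r a : ℕ) : ℝ) := by
  have htop : ∀ j ∈ Finset.Icc 1 (ℓ + 1), (r 1 j : ℝ) = minGT ℓ lam 1 j := by
    intro j hj
    rw [Finset.mem_Icc] at hj
    rw [hr.2 j hj.1 hj.2, minGT, if_pos (by unfold GTInRange; omega), Nat.add_sub_cancel_left]
  rw [psiGT_eq_sum_lowerIndices, psiGT_eq_sum_lowerIndices, Finset.sum_congr rfl htop, add_assoc,
    Nat.cast_sum, ← Finset.sum_add_distrib]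
  congr 1
  refine Finset.sum_congr rfl fun a _ => ?_
  rw [lam_add_excess hr a, minGT, if_pos (mem_lowerIndices.1 a.2).2, Nat.cast_add]

theorem rpow_psiGT_min_le_dLam {ℓ : ℕ} {q : ℝ} (hq : 0 < q) {lam : ℕ → ℕ}
    (hlam : ∀ j, 1 ≤ j → j + 1 ≤ ℓ + 1 → lam (j + 1) ≤ lam j) :
    q ^ (2 * psiGT ℓ (minGT ℓ lam)) ≤ dLam ℓ q lam := by
  rw [dLam, finsum_mem_eq_finite_toFinset_sum _ (finite_GTwith ℓ lam)]
  exact Finset.single_le_sum (f := fun r => q ^ (2 * psiGT ℓ r)) (fun _ _ => by positivity)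
    ((finite_GTwith ℓ lam).mem_toFinset.2 (minGT_mem hlam))

theorem dLam_le_mul_rpow_psiGT_min {ℓ : ℕ} {q : ℝ} (hq0 : 0 < q) (hq1 : q < 1) (lam : ℕ → ℕ) :
    dLam ℓ q lam ≤ ((1 - q ^ 2)⁻¹) ^ (lowerIndices ℓ).card *
      q ^ (2 * psiGT ℓ (minGT ℓ lam)) := by
  classical
  have hq2 : q ^ 2 < 1 := by nlinarith
  have hterm : ∀ r ∈ (finite_GTwith ℓ lam).toFinset, q ^ (2 * psiGT ℓ r) =
      (∏ a, (q ^ 2) ^ excess ℓ lam r a) * q ^ (2 * psiGT ℓ (minGT ℓ lam)) := by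
    intro r hr
    rw [psiGT_eq_min_add_excess ((finite_GTwith ℓ lam).mem_toFinset.1 hr), mul_add,
      Real.rpow_add hq0, mul_comm, Finset.prod_pow_eq_pow_sum, Real.rpow_mul hq0.le,
      Real.rpow_natCast, Real.rpow_ofNat]
  rw [dLam, finsum_mem_eq_finite_toFinset_sum _ (finite_GTwith ℓ lam),
    Finset.sum_congr rfl hterm, ← Finset.sum_mul]
  gcongr
  calc ∑ r ∈ (finite_GTwith ℓ lam).toFinset, ∏ a, (q ^ 2) ^ excess ℓ lam r a
      = ∑ p ∈ (finite_GTwith ℓ lam).toFinset.image (excess ℓ lam), ∏ a, (q ^ 2) ^ p a := by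
        rw [Finset.sum_image]
        simpa using excess_injOn ℓ lam
    _ ≤ ∑ p ∈ Fintype.piFinset fun _ : lowerIndices ℓ => Finset.range (lam 1 + 1),
          ∏ a, (q ^ 2) ^ p a := by
        refine Finset.sum_le_sum_of_subset_of_nonneg (Finset.image_subset_iff.2 fun r hr => ?_)
          fun _ _ _ => by positivity
        exact excess_mapsTo ℓ lam ((finite_GTwith ℓ lam).mem_toFinset.1 hr)
    _ = (∑ k ∈ Finset.range (lam 1 + 1), (q ^ 2) ^ k) ^ (lowerIndices ℓ).card := by
        rw [Finset.sum_prod_piFinset (Finset.range (lam 1 + 1))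
          (fun (_ : lowerIndices ℓ) k => (q ^ 2) ^ k), Finset.prod_const, Finset.card_univ,
          Fintype.card_coe]
    _ ≤ _ := by
        gcongr
        rw [← tsum_geometric_of_lt_one (by positivity) hq2]
        exact (summable_geometric_of_lt_one (by positivity) hq2).sum_le_tsum _
          fun _ _ => by positivity

/-- A bound for the change of `ψ` when every entry grows by at most one. -/
noncomputable def psiBound (ℓ : ℕ) : ℝ :=
  (ℓ : ℝ) / 2 * (ℓ + 1) + (lowerIndices ℓ).card

theorem abs_psiGT_sub_le {ℓ : ℕ} {r s : ℕ → ℕ → ℕ} (hrs : ∀ i j, r i j ≤ s i j)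
    (hsr : ∀ i j, s i j ≤ r i j + 1) : |psiGT ℓ r - psiGT ℓ s| ≤ psiBound ℓ := by
  have key : ∀ (ι : Type) (t : Finset ι) (f g : ι → ℕ), (∀ a, f a ≤ g a) →
      (∀ a, g a ≤ f a + 1) →
      (∑ a ∈ t, (f a : ℝ)) ≤ ∑ a ∈ t, (g a : ℝ) ∧
        (∑ a ∈ t, (g a : ℝ)) ≤ ∑ a ∈ t, (f a : ℝ) + t.card := by
    intro ι t f g h1 h2
    refine ⟨Finset.sum_le_sum fun a _ => by exact_mod_cast h1 a, ?_⟩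
    rw [Finset.card_eq_sum_ones, Nat.cast_sum, ← Finset.sum_add_distrib]
    exact Finset.sum_le_sum fun a _ => by exact_mod_cast h2 a
  obtain ⟨a1, a2⟩ := key _ (Finset.Icc 1 (ℓ + 1)) (r 1) (s 1) (hrs 1) (hsr 1)
  obtain ⟨b1, b2⟩ := key _ Finset.univ (fun a : lowerIndices ℓ => r a.1.1 a.1.2)
    (fun a => s a.1.1 a.1.2) (fun _ => hrs _ _) (fun _ => hsr _ _)
  rw [Nat.card_Icc, Nat.add_sub_cancel, Nat.cast_add, Nat.cast_one] at a2
  rw [Finset.card_univ, Fintype.card_coe] at b2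
  have hl : (0 : ℝ) ≤ (ℓ : ℝ) / 2 := by positivity
  have c1 := mul_le_mul_of_nonneg_left a1 hl
  have c2 := mul_le_mul_of_nonneg_left a2 hl
  have hc : (0 : ℝ) ≤ (ℓ : ℝ) / 2 * (ℓ + 1) := by positivity
  have hd : (0 : ℝ) ≤ (lowerIndices ℓ).card := by positivity
  rw [psiGT_eq_sum_lowerIndices, psiGT_eq_sum_lowerIndices, psiBound, abs_le]
  constructor <;> linarith

theorem le_moveGT (r : ℕ → ℕ → ℕ) (i : ℕ) (M : ℕ → ℕ) (a b : ℕ) :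
    r a b ≤ moveGT r i M a b := by
  unfold moveGT
  split_ifs <;> omega

theorem moveGT_le (r : ℕ → ℕ → ℕ) (i : ℕ) (M : ℕ → ℕ) (a b : ℕ) :
    moveGT r i M a b ≤ r a b + 1 := by
  unfold moveGT
  split_ifs <;> omega

theorem abs_psiGT_minGT_sub_le {ℓ : ℕ} {lam mu : ℕ → ℕ} (h : ∀ j, lam j ≤ mu j)
    (h' : ∀ j, mu j ≤ lam j + 1) :
    |psiGT ℓ (minGT ℓ lam) - psiGT ℓ (minGT ℓ mu)| ≤ psiBound ℓ := by
  refine abs_psiGT_sub_le (fun i j => ?_) fun i j => ?_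
  · unfold minGT
    split_ifs
    exacts [h _, le_rfl]
  · unfold minGT
    split_ifs
    exacts [h' _, Nat.zero_le _]

/-- there are constants `K₂ > K₁ > 0` depending only on `q` and
`ℓ` such that `K₁ < κ(r, M(r)) < K₂` for every GT tableau `r` and every move
`M` admissible for `r`. -/
theorem stmt_9 (ℓ : ℕ) (hℓ : 1 ≤ ℓ) (q : ℝ) (hq0 : 0 < q) (hq1 : q < 1) :
    ∃ K₁ K₂ : ℝ, 0 < K₁ ∧ K₁ < K₂ ∧
      ∀ (i : ℕ) (r : ℕ → ℕ → ℕ) (M : ℕ → ℕ), 1 ≤ i → i ≤ ℓ + 1 → IsGT ℓ r →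
        (∀ j, 1 ≤ j → j ≤ i → 1 ≤ M j ∧ M j ≤ ℓ + 2 - j) →
        IsGT ℓ (moveGT r i M) →
        K₁ < kappaGT ℓ q r (moveGT r i M) ∧ kappaGT ℓ q r (moveGT r i M) < K₂ := by
  have hq2 : 0 < 1 - q ^ 2 := by nlinarith
  set C : ℝ := ((1 - q ^ 2)⁻¹) ^ (lowerIndices ℓ).card with hC
  have hC0 : 0 < C := by positivity
  set B := psiBound ℓ with hB
  have main : ∀ (i : ℕ) (r : ℕ → ℕ → ℕ) (M : ℕ → ℕ), IsGT ℓ r → IsGT ℓ (moveGT r i M) →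
      √(C⁻¹ * q ^ (2 * B)) * q ^ B ≤ kappaGT ℓ q r (moveGT r i M) ∧
        kappaGT ℓ q r (moveGT r i M) ≤ √(C * q ^ (2 * -B)) * q ^ (-B) := by
    intro i r M hr hs
    have hψ := abs_le.1 (abs_psiGT_sub_le (ℓ := ℓ) (le_moveGT r i M) (moveGT_le r i M))
    have hmin := abs_le.1 (abs_psiGT_minGT_sub_le (ℓ := ℓ) (le_moveGT r i M 1) (moveGT_le r i M 1))
    have hr1 := rpow_psiGT_min_le_dLam hq0 fun j h1 h2 => hr.top_row_antitone (j := j) h1 h2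
    have hs1 := rpow_psiGT_min_le_dLam hq0 fun j h1 h2 => hs.top_row_antitone (j := j) h1 h2
    have hr2 := dLam_le_mul_rpow_psiGT_min (ℓ := ℓ) hq0 hq1 (r 1)
    have hs2 := dLam_le_mul_rpow_psiGT_min (ℓ := ℓ) hq0 hq1 (moveGT r i M 1)
    rw [← hC] at hr2 hs2
    rw [← hB] at hψ hmin
    set s := moveGT r i M
    set x := psiGT ℓ (minGT ℓ (r 1))
    set y := psiGT ℓ (minGT ℓ (s 1))
    have hds : 0 < dLam ℓ q (s 1) := (Real.rpow_pos_of_pos hq0 _).trans_le hs1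
    unfold kappaGT
    constructor
    · gcongr ?_ * ?_
      · refine Real.sqrt_le_sqrt ((le_div_iff₀ hds).2 ?_)
        calc C⁻¹ * q ^ (2 * B) * dLam ℓ q (s 1)
            ≤ C⁻¹ * q ^ (2 * B) * (C * q ^ (2 * y)) := by gcongr
          _ = q ^ (2 * B + 2 * y) := by rw [Real.rpow_add hq0]; field_simp
          _ ≤ q ^ (2 * x) := Real.rpow_le_rpow_of_exponent_ge hq0 hq1.le (by linarith)
          _ ≤ _ := hr1
      · exact Real.rpow_le_rpow_of_exponent_ge hq0 hq1.le hψ.2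
    · gcongr ?_ * ?_
      · refine Real.sqrt_le_sqrt ((div_le_iff₀ hds).2 ?_)
        calc dLam ℓ q (r 1) ≤ C * q ^ (2 * x) := hr2
          _ ≤ C * q ^ (2 * -B + 2 * y) := by
            gcongr C * ?_
            exact Real.rpow_le_rpow_of_exponent_ge hq0 hq1.le (by linarith)
          _ = C * q ^ (2 * -B) * q ^ (2 * y) := by rw [Real.rpow_add hq0, mul_assoc]
          _ ≤ _ := by gcongr
      · exact Real.rpow_le_rpow_of_exponent_ge hq0 hq1.le hψ.1
  have hlow : 0 < √(C⁻¹ * q ^ (2 * B)) * q ^ B := by positivity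
  refine ⟨√(C⁻¹ * q ^ (2 * B)) * q ^ B / 2,
    √(C⁻¹ * q ^ (2 * B)) * q ^ B + √(C * q ^ (2 * -B)) * q ^ (-B), by positivity, ?_, ?_⟩
  · have : 0 < √(C * q ^ (2 * -B)) * q ^ (-B) := by positivity
    linarith
  · intro i r M _ _ hr _ hs
    obtain ⟨h1, h2⟩ := main i r M hr hs
    constructor <;> linarith
end

section
/- Let c > 0 and let d : ℕ × ℕ → ℝ satisfy: d(n,k) ≠ 0 for all n, k; |d(n,k+1) − d(n,k)| ≤ c for all n, k ≥ 0; |d(n+1,0) − d(n,0)| ≤ c for all n ≥ 0; and for every R > 0 the set {(n,k) ∈ ℕ × ℕ : |d(n,k)| ≤ R} is finite. Then there exists a finite subset F ⊆ ℕ such that either the symmetric difference of {(n,k) : d(n,k) > 0} and F × ℕ is finite, or the symmetric difference of {(n,k) : d(n,k) < 0} and F × ℕ is finite. -/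
theorem pos_iff_pos_of_abs_sub_le {a b c : ℝ} (ha : c < |a|) (h : |b - a| ≤ c) :
    0 < b ↔ 0 < a := by
  rw [abs_le] at h
  rcases lt_abs.1 ha with h' | h' <;> constructor <;> intro <;> linarith

/-- A sequence whose steps are at most `c` keeps its sign while its absolute value exceeds `c`. -/
theorem pos_iff_pos_of_forall_abs_sub_le {u : ℕ → ℝ} {c : ℝ} {N : ℕ}
    (hu : ∀ k, N ≤ k → c < |u k|) (h : ∀ k, |u (k + 1) - u k| ≤ c) {k : ℕ} (hk : N ≤ k) :
    0 < u k ↔ 0 < u N := by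
  induction k, hk using Nat.le_induction with
  | base => rfl
  | succ k hk ih => exact (pos_iff_pos_of_abs_sub_le (hu k hk) (h k)).trans ih

/-- If a predicate on `ℕ × ℕ` fails on all rows `n ≥ N` and is constant along the columns `k ≥ N`
of each row, then it differs from a finite union of rows by a finite set. -/
theorem exists_finite_symmDiff_prod_univ {P : ℕ → ℕ → Prop} {N : ℕ}
    (hrow : ∀ n k, N ≤ n → ¬ P n k) (hcol : ∀ n k, N ≤ k → (P n k ↔ P n N)) :
    ∃ F : Set ℕ, F.Finite ∧
      (symmDiff {p : ℕ × ℕ | P p.1 p.2} (F ×ˢ (Set.univ : Set ℕ))).Finite := by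
  have hF : ∀ n, P n N → n < N := fun n hn => not_le.1 fun h => hrow n N h hn
  refine ⟨{n | P n N}, (Set.finite_Iio N).subset hF,
    ((Set.finite_Iio N).prod (Set.finite_Iio N)).subset ?_⟩
  rintro ⟨n, k⟩ hp
  simp only [Set.mem_symmDiff, Set.mem_ofPred_eq, Set.mem_prod, Set.mem_univ, and_true,
    Set.mem_Iio] at hp ⊢
  have hk : k < N := not_le.1 fun h => by
    have := hcol n k h
    tauto
  exact ⟨not_le.1 fun h => hp.elim (fun h' => hrow n k h h'.1) (fun h' => hrow n N h h'.1), hk⟩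

/-- if `d : ℕ × ℕ → ℝ` never vanishes, satisfies the growth
restrictions `|d(n,k+1) - d(n,k)| ≤ c` and `|d(n+1,0) - d(n,0)| ≤ c`, and for
every `R > 0` only finitely many values of `|d|` are `≤ R`, then there is a
finite set `F ⊆ ℕ` such that the set where `d > 0` (or the set where `d < 0`)
differs from `F × ℕ` by a finite set. -/
theorem stmt_13 (c : ℝ) (hc : 0 < c) (d : ℕ → ℕ → ℝ)
    (hne : ∀ n k : ℕ, d n k ≠ 0)
    (h1 : ∀ n k : ℕ, |d n (k + 1) - d n k| ≤ c)
    (h2 : ∀ n : ℕ, |d (n + 1) 0 - d n 0| ≤ c)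
    (hfin : ∀ R : ℝ, 0 < R → {p : ℕ × ℕ | |d p.1 p.2| ≤ R}.Finite) :
    ∃ F : Set ℕ, F.Finite ∧
      ((symmDiff {p : ℕ × ℕ | 0 < d p.1 p.2} (F ×ˢ (Set.univ : Set ℕ))).Finite ∨
        (symmDiff {p : ℕ × ℕ | d p.1 p.2 < 0} (F ×ˢ (Set.univ : Set ℕ))).Finite) := by
  obtain ⟨M, hM⟩ := (hfin c hc).bddAbove
  obtain ⟨N, hN₁, hN₂⟩ : ∃ N, M.1 < N ∧ M.2 < N :=
    ⟨max M.1 M.2 + 1, by omega, by omega⟩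
  have hlarge : ∀ n k, N ≤ n ∨ N ≤ k → c < |d n k| := by
    intro n k h
    by_contra! hle
    have hnk : (n, k) ≤ M := hM hle
    have h₁ : n ≤ M.1 := hnk.1
    have h₂ : k ≤ M.2 := hnk.2
    omega
  have hcol : ∀ n k, N ≤ k → (0 < d n k ↔ 0 < d n N) := fun n k hk =>
    pos_iff_pos_of_forall_abs_sub_le (fun k hk => hlarge n k (.inr hk)) (h1 n) hk
  have hrow : ∀ n k, N ≤ n → (0 < d n k ↔ 0 < d N 0) := fun n k hn =>
    (pos_iff_pos_of_forall_abs_sub_le (fun k _ => hlarge n k (.inl hn)) (h1 n) k.zero_le).trans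
      (pos_iff_pos_of_forall_abs_sub_le (u := fun n => d n 0)
        (fun n hn => hlarge n 0 (.inl hn)) h2 hn)
  have hneg : ∀ n k, d n k < 0 ↔ ¬ 0 < d n k := fun n k =>
    ⟨fun h => h.not_gt, fun h => (not_lt.1 h).lt_of_ne (hne n k)⟩
  by_cases h : 0 < d N 0
  · obtain ⟨F, hF, hd⟩ := exists_finite_symmDiff_prod_univ (P := fun n k => d n k < 0)
      (fun n k hn => by simpa only [hneg, not_not] using (hrow n k hn).2 h)
      (fun n k hk => by simpa only [hneg] using not_congr (hcol n k hk))
    exact ⟨F, hF, .inr hd⟩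
  · obtain ⟨F, hF, hd⟩ := exists_finite_symmDiff_prod_univ (P := fun n k => 0 < d n k)
      (fun n k hn => by rwa [hrow n k hn]) hcol
    exact ⟨F, hF, .inl hd⟩
end

section
/- Define d : ℕ × ℕ → ℤ by d(0,k) = −k and d(n,k) = n+k for n ≥ 1. Let c > 0 and let d₀ : ℕ × ℕ → ℝ satisfy |d₀(n,k+1) − d₀(n,k)| ≤ c for all n, k ≥ 0 and |d₀(n+1,0) − d₀(n,0)| ≤ c for all n ≥ 0. Then there exist reals a, b > 0 such that |d₀(n,k)| ≤ a + b·|d(n,k)| for all n, k ∈ ℕ. -/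
/-- The eigenvalue sequence of the optimal equivariant Dirac operator:
`d(0,k) = -k` and `d(n,k) = n + k` for `n ≥ 1`. -/
def dOpt : ℕ → ℕ → ℤ :=
  fun n k => if n = 0 then -(k : ℤ) else (n : ℤ) + (k : ℤ)

/-- optimality: if `d₀ : ℕ × ℕ → ℝ` satisfies
`|d₀(n,k+1) - d₀(n,k)| ≤ c` and `|d₀(n+1,0) - d₀(n,0)| ≤ c`, then there are
reals `a, b > 0` with `|d₀(n,k)| ≤ a + b |d(n,k)|` for all `n, k`. -/
theorem stmt_16 (c : ℝ) (hc : 0 < c) (d₀ : ℕ → ℕ → ℝ)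
    (h1 : ∀ n k : ℕ, |d₀ n (k + 1) - d₀ n k| ≤ c)
    (h2 : ∀ n : ℕ, |d₀ (n + 1) 0 - d₀ n 0| ≤ c) :
    ∃ a b : ℝ, 0 < a ∧ 0 < b ∧
      ∀ n k : ℕ, |d₀ n k| ≤ a + b * |(dOpt n k : ℝ)| := by
  have hcol : ∀ n : ℕ, |d₀ n 0| ≤ |d₀ 0 0| + c * n := by
    intro n
    induction n with
    | zero => simp
    | succ n ih =>
      have := abs_sub_abs_le_abs_sub (d₀ (n + 1) 0) (d₀ n 0)
      have := h2 n
      push_cast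
      linarith
  have hrow : ∀ n k : ℕ, |d₀ n k| ≤ |d₀ 0 0| + c * (n + k) := by
    intro n k
    induction k with
    | zero => simpa using hcol n
    | succ k ih =>
      have := abs_sub_abs_le_abs_sub (d₀ n (k + 1)) (d₀ n k)
      have := h1 n k
      push_cast
      linarith
  have hd : ∀ n k : ℕ, |(dOpt n k : ℝ)| = n + k := by
    intro n k
    unfold dOpt
    split_ifs with hn
    · simp [hn]
    · push_cast
      exact abs_of_nonneg (by positivity)
  refine ⟨|d₀ 0 0| + 1, c, by positivity, hc, fun n k => ?_⟩
  rw [hd]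
  linarith [hrow n k]
end
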